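/- arXiv:1612.03793 — 2 statements merged into one kernel-verified Lean document; each statement's English description precedes it below -/
import Mathlib

section
/- Let F = ℝ or ℂ and let M(λ) = M_0 + M_1λ + ⋯ + M_dλ^d ∈ F[λ]^{m×(m+n)}_d be a minimal basis with rank(M_d) < m. Then for every ε > 0 there exists a polynomial matrix M̃(λ) ∈ F[λ]^{m×(m+n)}_d that is not a minimal basis and satisfies ‖S_1(M) − S_1(M̃)‖_2 < ε; that is, arbitrarily close to M(λ) there are polynomial matrices of degree at most d that are not minimal bases. -/
open Polynomial Matrix

noncomputable section

variable {F : Type*} [Field F]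

/-- The rows of a polynomial matrix, viewed as vectors of rational functions. -/
def ratRow {p q : ℕ} (M : Matrix (Fin p) (Fin q) F[X]) (i : Fin p) :
    Fin q → RatFunc F :=
  fun j => algebraMap F[X] (RatFunc F) (M i j)

/-- The rational vector subspace spanned by the rows of a polynomial matrix. -/
def rowSpan {p q : ℕ} (M : Matrix (Fin p) (Fin q) F[X]) :
    Submodule (RatFunc F) (Fin q → RatFunc F) :=
  Submodule.span (RatFunc F) (Set.range (ratRow M))

/-- The degree of the `i`-th row of a polynomial matrix. -/
def rowDeg {p q : ℕ} (M : Matrix (Fin p) (Fin q) F[X]) (i : Fin p) : ℕ :=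
  Finset.univ.sup fun j => (M i j).natDegree

/-- The rows of `M` form a polynomial basis of the rational subspace `V` whose sum of
row degrees is minimal among all polynomial bases of `V`. -/
def IsMinimalBasisOf {p q : ℕ} (V : Submodule (RatFunc F) (Fin q → RatFunc F))
    (M : Matrix (Fin p) (Fin q) F[X]) : Prop :=
  LinearIndependent (RatFunc F) (ratRow M) ∧ rowSpan M = V ∧
    ∀ M' : Matrix (Fin p) (Fin q) F[X],
      LinearIndependent (RatFunc F) (ratRow M') → rowSpan M' = V →
        ∑ i, rowDeg M i ≤ ∑ i, rowDeg M' i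

/-- A polynomial matrix is a minimal basis if its rows form a minimal basis of the
rational subspace they span. -/
def IsMinimalBasis {p q : ℕ} (M : Matrix (Fin p) (Fin q) F[X]) : Prop :=
  IsMinimalBasisOf (rowSpan M) M

/-- A polynomial matrix viewed as a matrix of rational functions. -/
def ratMat {p q : ℕ} (M : Matrix (Fin p) (Fin q) F[X]) :
    Matrix (Fin p) (Fin q) (RatFunc F) :=
  M.map (algebraMap F[X] (RatFunc F))

/-- The right null-space over `F(λ)` of a polynomial matrix. -/
def rightNullSpace {p q : ℕ} (M : Matrix (Fin p) (Fin q) F[X]) :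
    Submodule (RatFunc F) (Fin q → RatFunc F) :=
  LinearMap.ker (Matrix.mulVecLin (ratMat M))

/-- The `k`-th Sylvester matrix of a polynomial matrix regarded as having degree at
most `e`: the block-Toeplitz matrix with `k` block columns whose `j`-th block column
carries the coefficients `M_0, …, M_e` in block rows `j, …, j+e` and zeros elsewhere. -/
def sylv {p q : ℕ} (e k : ℕ) (M : Matrix (Fin p) (Fin q) F[X]) :
    Matrix (Fin (k + e) × Fin p) (Fin k × Fin q) F :=
  fun r c =>
    if (c.1 : ℕ) ≤ (r.1 : ℕ) ∧ (r.1 : ℕ) ≤ (c.1 : ℕ) + e then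
      (M r.2 c.2).coeff ((r.1 : ℕ) - (c.1 : ℕ))
    else 0

/-- `M`, regarded as a polynomial matrix of degree at most `e`, has
full-Sylvester-rank if every Sylvester matrix `S_k`, `k ≥ 1`, has full rank. -/
def HasFullSylvesterRank {p q : ℕ} (e : ℕ) (M : Matrix (Fin p) (Fin q) F[X]) : Prop :=
  ∀ k : ℕ, 1 ≤ k → (sylv e k M).rank = min ((k + e) * p) (k * q)

/-- The `k`-th coefficient matrix of a polynomial matrix. -/
def coeffMat {p q : ℕ} (k : ℕ) (M : Matrix (Fin p) (Fin q) F[X]) :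
    Matrix (Fin p) (Fin q) F :=
  fun i j => (M i j).coeff k

/-- The highest-row-degree coefficient matrix: its `i`-th row is the coefficient of
`λ^{d_i}` in the `i`-th row of `M`, where `d_i` is the `i`-th row degree. -/
def highRowMat {p q : ℕ} (M : Matrix (Fin p) (Fin q) F[X]) :
    Matrix (Fin p) (Fin q) F :=
  fun i j => (M i j).coeff (rowDeg M i)

/-- The `e`-reversal of a polynomial matrix: `rev_e P(λ) = λ^e P(1/λ)`. -/
def revMat {p q : ℕ} (e : ℕ) (P : Matrix (Fin p) (Fin q) F[X]) :
    Matrix (Fin p) (Fin q) F[X] :=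
  fun i j => (P i j).reflect e


variable {𝕜 : Type*} [RCLike 𝕜]

/-- The spectral norm (largest singular value) of a matrix. -/
def sNorm {a b : Type*} [Fintype a] [Fintype b] [DecidableEq b]
    (A : Matrix a b 𝕜) : ℝ :=
  ‖LinearMap.toContinuousLinearMap (Matrix.toEuclideanLin A)‖

/-- The Frobenius norm of a matrix. -/
def fNorm {a b : Type*} [Fintype a] [Fintype b] (A : Matrix a b 𝕜) : ℝ :=
  Real.sqrt (∑ i, ∑ j, ‖A i j‖ ^ 2)

/-- The `j`-th largest singular value of a matrix (`j = 1, 2, …`), via the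
Courant–Fischer variational characterization. -/
def singVal {a b : Type*} [Fintype a] [Fintype b] [DecidableEq b]
    (A : Matrix a b 𝕜) (j : ℕ) : ℝ :=
  sSup {r : ℝ | ∃ V : Submodule 𝕜 (EuclideanSpace 𝕜 b),
    Module.finrank 𝕜 V = j ∧ ∀ x ∈ V, r * ‖x‖ ≤ ‖Matrix.toEuclideanLin A x‖}


/-- A minimal basis keeps full row rank when evaluated at any point: a nontrivial constant
combination of its rows never vanishes at a point. -/
lemma not_isMinimalBasis_of_combination_isRoot {K : Type*} [Field K] {p q : ℕ}
    (M : Matrix (Fin p) (Fin q) K[X]) (a : Fin p → K) (ha : a ≠ 0) (x : K)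
    (hroot : ∀ j, (∑ k, C (a k) * M k j).IsRoot x) : ¬ IsMinimalBasis M := by
  classical
  rintro ⟨hli, -, hmin⟩
  obtain ⟨i₀, hi₀⟩ := Function.ne_iff.mp ha
  obtain ⟨i, hi, himax⟩ := Finset.exists_max_image
    (Finset.univ.filter fun k => a k ≠ 0) (rowDeg M) ⟨i₀, by simpa using hi₀⟩
  have hai : a i ≠ 0 := by simpa using hi
  choose w hw using fun j => dvd_iff_isRoot.mpr (hroot j)
  have hdegM : ∀ k j, (M k j).natDegree ≤ rowDeg M k := fun k j =>
    Finset.le_sup (f := fun j => (M k j).natDegree) (Finset.mem_univ j)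
  have hcomb : ∀ j, (∑ k, C (a k) * M k j).natDegree ≤ rowDeg M i := by
    refine fun j => natDegree_sum_le_of_forall_le _ _ fun k _ => ?_
    by_cases hk : a k = 0
    · simp [hk]
    · exact (natDegree_C_mul_le _ _).trans
        ((hdegM k j).trans (himax k (by simpa using hk)))
  have hX : algebraMap K[X] (RatFunc K) (X - C x) ≠ 0 :=
    RatFunc.algebraMap_ne_zero (X_sub_C_ne_zero x)
  have haC : algebraMap K[X] (RatFunc K) (C (a i)) ≠ 0 :=
    RatFunc.algebraMap_ne_zero (C_ne_zero.mpr hai)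
  set r : Fin q → RatFunc K := fun j => algebraMap K[X] (RatFunc K) (w j) with hr
  have hrel : algebraMap K[X] (RatFunc K) (X - C x) • r =
      ∑ k, algebraMap K[X] (RatFunc K) (C (a k)) • ratRow M k := by
    ext j
    simp only [hr, ratRow, Pi.smul_apply, smul_eq_mul, Finset.sum_apply, ← map_mul, ← hw, map_sum]
  have hw0 : ∃ j, w j ≠ 0 := by
    by_contra! h
    have hr0 : r = 0 := by ext j; simp [hr, h j]
    rw [hr0, smul_zero] at hrel
    exact haC (Fintype.linearIndependent_iff.mp hli _ hrel.symm i)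
  have hwdeg : ∀ j, w j ≠ 0 → (w j).natDegree + 1 ≤ rowDeg M i := by
    intro j hj
    have h := hcomb j
    rw [hw j, natDegree_mul (X_sub_C_ne_zero x) hj, natDegree_X_sub_C] at h
    omega
  have hpos : 0 < rowDeg M i := by
    obtain ⟨j, hj⟩ := hw0
    have := hwdeg j hj
    omega
  set M' : Matrix (Fin p) (Fin q) K[X] := fun k => if k = i then w else M k with hM'
  have hM'i : ratRow M' i = r := by ext j; simp [ratRow, hM', hr]
  have hM'k : ∀ k, k ≠ i → ratRow M' k = ratRow M k := by
    intro k hk; ext j; simp [ratRow, hM', hk]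
  have hmem : ∀ k, ratRow M k ∈ rowSpan M := fun k => Submodule.subset_span ⟨k, rfl⟩
  have hmem' : ∀ k, ratRow M' k ∈ rowSpan M' := fun k => Submodule.subset_span ⟨k, rfl⟩
  have hspan : rowSpan M' = rowSpan M := by
    apply le_antisymm
    · refine Submodule.span_le.mpr ?_
      rintro _ ⟨k, rfl⟩
      by_cases hk : k = i
      · subst hk
        rw [hM'i, SetLike.mem_coe, ← Submodule.smul_mem_iff _ hX, hrel]
        exact Submodule.sum_mem _ fun k _ => Submodule.smul_mem _ _ (hmem k)
      · rw [hM'k k hk]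
        exact hmem k
    · refine Submodule.span_le.mpr ?_
      rintro _ ⟨k, rfl⟩
      by_cases hk : k = i
      · subst hk
        rw [SetLike.mem_coe, ← Submodule.smul_mem_iff _ haC]
        rw [← Finset.add_sum_erase _ _ (Finset.mem_univ k), ← sub_eq_iff_eq_add] at hrel
        rw [← hrel]
        refine Submodule.sub_mem _ (Submodule.smul_mem _ _ (hM'i ▸ hmem' k))
          (Submodule.sum_mem _ fun l hl => Submodule.smul_mem _ _ ?_)
        rw [← hM'k l (Finset.ne_of_mem_erase hl)]
        exact hmem' l
      · rw [← hM'k k hk]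
        exact hmem' k
  have hli' : LinearIndependent (RatFunc K) (ratRow M') := by
    rw [linearIndependent_iff_card_eq_finrank_span] at hli ⊢
    rw [hli]
    exact congrArg (fun V : Submodule (RatFunc K) (Fin q → RatFunc K) =>
      Module.finrank (RatFunc K) V) hspan.symm
  refine (hmin M' hli' hspan).not_gt (Finset.sum_lt_sum (fun k _ => ?_) ⟨i, Finset.mem_univ i, ?_⟩)
  · by_cases hk : k = i
    · subst hk
      refine Finset.sup_le fun j _ => ?_
      by_cases hj : w j = 0
      · simp [hM', hj]
      · simpa [hM'] using (Nat.le_succ _).trans (hwdeg j hj)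
    · simp [rowDeg, hM', hk]
  · refine (Finset.sup_lt_iff hpos).mpr fun j _ => ?_
    by_cases hj : w j = 0
    · simpa [hM', hj] using hpos
    · simpa [hM'] using hwdeg j hj

/-- The spectral norm is continuous on matrices. -/
lemma continuous_sNorm {𝕜 : Type*} [RCLike 𝕜] {a b : Type*} [Fintype a] [Fintype b]
    [DecidableEq b] : Continuous (sNorm : Matrix a b 𝕜 → ℝ) := by
  have h : Continuous ((LinearMap.toContinuousLinearMap :
      (EuclideanSpace 𝕜 b →ₗ[𝕜] EuclideanSpace 𝕜 a) ≃ₗ[𝕜] _).toLinearMap ∘ₗ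
      (Matrix.toEuclideanLin : Matrix a b 𝕜 ≃ₗ[𝕜] _).toLinearMap) :=
    LinearMap.continuous_of_finiteDimensional _
  exact h.norm

/-- A matrix of deficient row rank has a nonzero left null vector. -/
lemma exists_vecMul_eq_zero_of_rank_lt {K : Type*} [Field K] {p q : ℕ}
    (A : Matrix (Fin p) (Fin q) K) (hA : A.rank < p) : ∃ a, a ≠ 0 ∧ a ᵥ* A = 0 := by
  have h : ¬ LinearIndependent K A.row := fun h => by
    have := h.rank_matrix
    simp at this
    omega
  obtain ⟨a, ha, i, hi⟩ := Fintype.not_linearIndependent_iff.mp h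
  refine ⟨a, fun h => hi (by simp [h]), ?_⟩
  rw [Matrix.vecMul_eq_sum]
  exact ha

/-- A minimal basis whose leading coefficient `M_d` is rank deficient is not robust:
arbitrarily close to it (in the distance `‖S_1(M) - S_1(M̃)‖_2` on polynomial
matrices of degree at most `d`) there are polynomial matrices that are not minimal
bases. -/
theorem not_robust_of_rank_leading_lt {𝕜 : Type*} [RCLike 𝕜] {m n d : ℕ}
    (hm : 0 < m) (hn : 0 < n) (hd : 0 < d)
    (M : Matrix (Fin m) (Fin (m + n)) 𝕜[X]) (hdeg : ∀ i j, (M i j).natDegree ≤ d)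
    (hmb : IsMinimalBasis M) (hMd : (coeffMat d M).rank < m) :
    ∀ ε : ℝ, 0 < ε →
      ∃ M' : Matrix (Fin m) (Fin (m + n)) 𝕜[X],
        (∀ i j, (M' i j).natDegree ≤ d) ∧ ¬ IsMinimalBasis M' ∧
        sNorm (sylv d 1 M - sylv d 1 M') < ε := by
  intro ε hε
  obtain ⟨a, ha, haM⟩ := exists_vecMul_eq_zero_of_rank_lt _ hMd
  obtain ⟨i, hi⟩ := Function.ne_iff.mp ha
  have hi : a i ≠ 0 := hi
  set c : 𝕜 → Fin (m + n) → 𝕜 := fun δ j =>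
    (a i)⁻¹ * ∑ k, a k * ((M k j).reflect d).eval δ with hc
  set N : 𝕜 → Matrix (Fin m) (Fin (m + n)) 𝕜[X] := fun δ k j =>
    M k j - C (if k = i then c δ j else 0) * X ^ d with hN
  have hcoeff : ∀ δ, sylv d 1 M - sylv d 1 (N δ) = fun r s =>
      if (s.1 : ℕ) ≤ (r.1 : ℕ) ∧ (r.1 : ℕ) ≤ (s.1 : ℕ) + d then
        if (r.1 : ℕ) - (s.1 : ℕ) = d then (if r.2 = i then c δ s.2 else 0) else 0
      else 0 := by
    intro δ
    ext r s
    simp only [Matrix.sub_apply, sylv, hN, coeff_sub, coeff_C_mul_X_pow]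
    split_ifs <;> simp_all
  have hccont : ∀ j, Continuous fun δ => c δ j := fun j => by
    simp only [hc]
    fun_prop
  have hc0 : ∀ j, c 0 j = 0 := fun j => by
    have h := congrFun haM j
    simp only [Matrix.vecMul, dotProduct, coeffMat, Pi.zero_apply] at h
    simp [hc, ← coeff_zero_eq_eval_zero, coeff_reflect, h]
  have hcont : Continuous fun δ => sNorm (sylv d 1 M - sylv d 1 (N δ)) := by
    refine continuous_sNorm.comp ?_
    simp only [hcoeff]
    refine continuous_matrix fun r s => ?_
    split_ifs <;> first | exact hccont _ | exact continuous_const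
  have hzero : sNorm (sylv d 1 M - sylv d 1 (N 0)) < ε := by
    have h : N 0 = M := by ext1 k j; simp [hN, hc0]
    rw [h, sub_self]
    simpa [sNorm] using hε
  have hev : ∀ᶠ δ in nhdsWithin (0 : 𝕜) {0}ᶜ, sNorm (sylv d 1 M - sylv d 1 (N δ)) < ε :=
    (hcont.continuousAt.eventually_lt_const hzero).filter_mono nhdsWithin_le_nhds
  obtain ⟨δ, hδε, hδ⟩ := (hev.and self_mem_nhdsWithin).exists
  have hδ : δ ≠ 0 := hδ
  refine ⟨N δ, fun k j => ?_, ?_, hδε⟩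
  · simpa using natDegree_sub_le_of_le (hdeg k j) (natDegree_C_mul_X_pow_le _ d)
  refine not_isMinimalBasis_of_combination_isRoot _ a ha δ⁻¹ fun j => ?_
  have hrefl : ∀ k, ((M k j).reflect d).eval δ * δ⁻¹ ^ d = (M k j).eval δ⁻¹ := fun k => by
    let _ : Invertible δ⁻¹ := invertibleOfNonzero (inv_ne_zero hδ)
    simpa [eval₂_id] using eval₂_reflect_mul_pow (RingHom.id 𝕜) δ⁻¹ d (M k j) (hdeg k j)
  simp only [IsRoot.def, eval_finsetSum, eval_mul, eval_C, hN, eval_sub, eval_pow, eval_X,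
    mul_sub, Finset.sum_sub_distrib, ite_mul, mul_ite, zero_mul, mul_zero, Finset.sum_ite_eq',
    Finset.mem_univ, if_true, hc, ← hrefl]
  rw [← mul_assoc, mul_inv_cancel_left₀ hi, Finset.sum_mul, sub_eq_zero]
  exact Finset.sum_congr rfl fun k _ => by ring

end
end

section
/- Let F = ℝ or ℂ and let M(λ) = M_0 + M_1λ + ⋯ + M_dλ^d ∈ F[λ]^{m×(m+n)}_d be a minimal basis with rank(M_d) = m. Then there exists an index k such that the Sylvester matrix S_k(M) has full row rank, and for any such k, every polynomial matrix M̃(λ) = M̃_0 + M̃_1λ + ⋯ + M̃_dλ^d ∈ F[λ]^{m×(m+n)}_d satisfying ‖S_1(M) − S_1(M̃)‖_2 < σ_{(k+d)m}(S_k(M))/√k is a minimal basis with rank(M̃_d) = m. -/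
open Polynomial Matrix

noncomputable section

variable {F : Type*} [Field F]

variable {𝕜 : Type*} [RCLike 𝕜]

section FullRowRank

theorem rank_eq_iff_mulVec_surjective {a b : Type*} [Fintype a] [Fintype b]
    (A : Matrix a b F) :
    A.rank = Fintype.card a ↔ Function.Surjective A.mulVec := by
  rw [Matrix.rank, ← Module.finrank_fintype_fun_eq_card F]
  constructor
  · intro h
    exact LinearMap.range_eq_top.mp (Submodule.eq_top_of_finrank_eq h)
  · intro h
    have : LinearMap.range A.mulVecLin = ⊤ := LinearMap.range_eq_top.mpr h
    rw [this, finrank_top]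

theorem rank_eq_iff_exists_right_inverse {p q : ℕ} (A : Matrix (Fin p) (Fin q) F) :
    A.rank = p ↔ ∃ B : Matrix (Fin q) (Fin p) F, A * B = 1 := by
  rw [← Matrix.mulVec_surjective_iff_exists_right_inverse, ← rank_eq_iff_mulVec_surjective,
    Fintype.card_fin]

theorem degree_finsetSum_lt {ι : Type*} {s : Finset ι} {f : ι → F[X]} {N : ℕ}
    (h : ∀ i ∈ s, (f i).degree < N) : (∑ i ∈ s, f i).degree < N := by
  rw [← Polynomial.mem_degreeLT]
  exact Submodule.sum_mem _ fun i hi => Polynomial.mem_degreeLT.mpr (h i hi)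

theorem degree_mul_lt {f g : F[X]} {a b : ℕ} (hf : f.degree < a) (hg : g.natDegree ≤ b) :
    (f * g).degree < ((a + b : ℕ) : WithBot ℕ) := by
  by_cases hf0 : f = 0
  · simp [hf0]
  rw [← Polynomial.natDegree_lt_iff_degree_lt hf0] at hf
  refine lt_of_le_of_lt Polynomial.degree_le_natDegree ?_
  have := Polynomial.natDegree_mul_le (p := f) (q := g)
  exact_mod_cast (by omega : (f * g).natDegree < a + b)

/-- The polynomial vector of degree less than `k` with prescribed coefficients. -/
def polyVec {k q : ℕ} (x : Fin k × Fin q → F) (j : Fin q) : F[X] :=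
  ∑ c : Fin k, monomial (c : ℕ) (x (c, j))

theorem polyVec_degree_lt {k q : ℕ} (x : Fin k × Fin q → F) (j : Fin q) :
    (polyVec x j).degree < k :=
  degree_finsetSum_lt fun c _ =>
    (Polynomial.degree_monomial_le _ _).trans_lt (by exact_mod_cast c.2)

theorem polyVec_coeff {k q : ℕ} (v : Fin q → F[X]) (hv : ∀ j, (v j).degree < k) :
    polyVec (fun c : Fin k × Fin q => (v c.2).coeff c.1) = v := by
  funext j
  rw [polyVec, Fin.sum_univ_eq_sum_range (fun c => monomial c ((v j).coeff c)) k]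
  by_cases h0 : v j = 0
  · simp [h0]
  exact (Polynomial.as_sum_range' (v j) k
    ((Polynomial.natDegree_lt_iff_degree_lt h0).mpr (hv j))).symm

theorem sylv_mulVec {p q e k : ℕ} (M : Matrix (Fin p) (Fin q) F[X])
    (hM : ∀ i j, (M i j).natDegree ≤ e) (x : Fin k × Fin q → F)
    (r : Fin (k + e) × Fin p) :
    (sylv e k M *ᵥ x) r = ((M *ᵥ polyVec x) r.2).coeff r.1 := by
  simp only [Matrix.mulVec, dotProduct, polyVec, Polynomial.finsetSum_coeff, Finset.mul_sum]
  rw [Fintype.sum_prod_type_right]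
  refine Finset.sum_congr rfl fun j _ => Finset.sum_congr rfl fun c _ => ?_
  rw [← Polynomial.C_mul_X_pow_eq_monomial, ← mul_assoc, Polynomial.coeff_mul_X_pow',
    Polynomial.coeff_mul_C, sylv]
  by_cases h1 : (c : ℕ) ≤ r.1
  · by_cases h2 : (r.1 : ℕ) ≤ c + e
    · simp [h1, h2]
    · have : (M r.2 j).coeff ((r.1 : ℕ) - c) = 0 :=
        Polynomial.coeff_eq_zero_of_natDegree_lt ((hM _ _).trans_lt (by omega))
      simp [h1, h2, this]
  · simp [h1]

theorem mulVec_degree_lt {p q e k : ℕ} (M : Matrix (Fin p) (Fin q) F[X])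
    (hM : ∀ i j, (M i j).natDegree ≤ e) (v : Fin q → F[X]) (hv : ∀ j, (v j).degree < k)
    (i : Fin p) : ((M *ᵥ v) i).degree < ((k + e : ℕ) : WithBot ℕ) := by
  rw [Matrix.mulVec, dotProduct]
  refine degree_finsetSum_lt fun j _ => ?_
  rw [mul_comm]
  exact degree_mul_lt (hv j) (hM i j)

/-- A Sylvester matrix has full row rank iff every polynomial vector of degree less than
`k + e` is the image of one of degree less than `k`. -/
theorem sylv_rank_iff {p q e k : ℕ} (M : Matrix (Fin p) (Fin q) F[X])
    (hM : ∀ i j, (M i j).natDegree ≤ e) :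
    (sylv e k M).rank = (k + e) * p ↔
      ∀ g : Fin p → F[X], (∀ i, (g i).degree < ((k + e : ℕ) : WithBot ℕ)) →
        ∃ v : Fin q → F[X], (∀ j, (v j).degree < k) ∧ M *ᵥ v = g := by
  have hc : (k + e) * p = Fintype.card (Fin (k + e) × Fin p) := by simp
  rw [hc, rank_eq_iff_mulVec_surjective]
  constructor
  · intro h g hg
    obtain ⟨x, hx⟩ := h fun r => (g r.2).coeff r.1
    refine ⟨polyVec x, polyVec_degree_lt x, ?_⟩
    funext i
    ext s
    by_cases hs : s < k + e
    · have := congrFun hx (⟨s, hs⟩, i)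
      rwa [sylv_mulVec M hM] at this
    · rw [(Polynomial.degree_lt_iff_coeff_zero _ _).mp (hg i) s (by omega),
        (Polynomial.degree_lt_iff_coeff_zero _ _).mp
          (mulVec_degree_lt M hM _ (polyVec_degree_lt x) i) s (by omega)]
  · intro h y
    obtain ⟨v, hv, hvg⟩ := h (polyVec y) (polyVec_degree_lt y)
    refine ⟨fun c => (v c.2).coeff c.1, ?_⟩
    funext r
    rw [sylv_mulVec M hM, polyVec_coeff v hv, hvg, polyVec, Polynomial.finsetSum_coeff]
    rw [Finset.sum_eq_single r.1]
    · simp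
    · intro b _ hb
      rw [Polynomial.coeff_monomial, if_neg (fun h => hb (Fin.ext h))]
    · simp

theorem exists_division_by_rank_leading {p q e : ℕ} (M : Matrix (Fin p) (Fin q) F[X])
    (hM : ∀ i j, (M i j).natDegree ≤ e) (hlead : (coeffMat e M).rank = p) (t : ℕ)
    (g : Fin p → F[X]) (hg : ∀ i, (g i).degree < ((t + e : ℕ) : WithBot ℕ)) :
    ∃ (v : Fin q → F[X]) (h : Fin p → F[X]), (∀ j, (v j).degree < t) ∧
      (∀ i, (h i).degree < e) ∧ g = M *ᵥ v + h := by
  induction t generalizing g with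
  | zero => exact ⟨0, g, by simp, by simpa using hg, by simp⟩
  | succ t ih =>
    obtain ⟨B, hB⟩ := (rank_eq_iff_exists_right_inverse _).mp hlead
    set y : Fin q → F := B *ᵥ fun i => (g i).coeff (t + e) with hy
    have hMy : coeffMat e M *ᵥ y = fun i => (g i).coeff (t + e) := by
      rw [hy, Matrix.mulVec_mulVec, hB, Matrix.one_mulVec]
    set u : Fin q → F[X] := fun j => monomial t (y j) with hu
    have hudeg : ∀ j, (u j).degree < ((t + 1 : ℕ) : WithBot ℕ) := fun j =>
      (Polynomial.degree_monomial_le _ _).trans_lt (by exact_mod_cast Nat.lt_succ_self t)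
    obtain ⟨v, h, hv, hh, hgv⟩ := ih (g - M *ᵥ u) fun i => by
      rw [Polynomial.degree_lt_iff_coeff_zero]
      intro s hs
      rw [Pi.sub_apply, Polynomial.coeff_sub, sub_eq_zero]
      rcases hs.eq_or_lt with rfl | hs
      · rw [← congrFun hMy i]
        simp only [Matrix.mulVec, dotProduct, Polynomial.finsetSum_coeff, hu, coeffMat]
        refine Finset.sum_congr rfl fun j _ => ?_
        rw [add_comm t e, Polynomial.coeff_mul_monomial]
      · rw [(Polynomial.degree_lt_iff_coeff_zero _ _).mp (hg i) s (by omega),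
          (Polynomial.degree_lt_iff_coeff_zero _ _).mp
            (mulVec_degree_lt M hM _ hudeg i) s (by omega)]
    refine ⟨v + u, h, fun j => ?_, hh, ?_⟩
    · refine (Polynomial.degree_add_le _ _).trans_lt (max_lt ((hv j).trans ?_) (hudeg j))
      exact_mod_cast Nat.lt_succ_self t
    · rw [Matrix.mulVec_add, add_right_comm, ← hgv, sub_add_cancel]

theorem exists_sylv_rank_eq {p q e : ℕ} (he : 0 < e) (M : Matrix (Fin p) (Fin q) F[X])
    (hM : ∀ i j, (M i j).natDegree ≤ e) (hlead : (coeffMat e M).rank = p)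
    (R : Matrix (Fin q) (Fin p) F[X]) (hR : M * R = 1) :
    ∃ k : ℕ, 1 ≤ k ∧ (sylv e k M).rank = (k + e) * p := by
  set D := Finset.univ.sup fun j => Finset.univ.sup fun i => (R j i).natDegree with hD
  have hRD : ∀ j i, (R j i).natDegree ≤ D := fun j i =>
    (Finset.le_sup (f := fun i => (R j i).natDegree) (Finset.mem_univ i)).trans
      (Finset.le_sup (f := fun j => Finset.univ.sup fun i => (R j i).natDegree)
        (Finset.mem_univ j))
  refine ⟨e + D, by omega, (sylv_rank_iff M hM).mpr fun g hg => ?_⟩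
  obtain ⟨v, h, hv, hh, rfl⟩ := exists_division_by_rank_leading M hM hlead _ g hg
  refine ⟨v + R *ᵥ h, fun j => ?_, ?_⟩
  · exact (Polynomial.degree_add_le _ _).trans_lt
      (max_lt (hv j) (mulVec_degree_lt R hRD h hh j))
  · rw [Matrix.mulVec_add, Matrix.mulVec_mulVec, hR, Matrix.one_mulVec]

theorem rank_leading_of_sylv_rank {p q e k : ℕ} (hk : 1 ≤ k) (M : Matrix (Fin p) (Fin q) F[X])
    (hM : ∀ i j, (M i j).natDegree ≤ e) (h : (sylv e k M).rank = (k + e) * p) :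
    (coeffMat e M).rank = p := by
  rw [sylv_rank_iff M hM] at h
  refine Eq.trans ((rank_eq_iff_mulVec_surjective _).mpr ?_) (Fintype.card_fin p)
  intro y
  obtain ⟨v, hv, hvy⟩ := h (fun i => monomial (e + (k - 1)) (y i)) fun i =>
    (Polynomial.degree_monomial_le _ _).trans_lt (by exact_mod_cast (by omega))
  refine ⟨fun j => (v j).coeff (k - 1), ?_⟩
  funext i
  have hi := congrArg (fun f : F[X] => f.coeff (e + (k - 1))) (congrFun hvy i)
  simp only [Polynomial.coeff_monomial, if_true] at hi
  rw [← hi]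
  simp only [Matrix.mulVec, dotProduct, Polynomial.finsetSum_coeff, coeffMat]
  refine Finset.sum_congr rfl fun j _ => (Polynomial.coeff_mul_add_eq_of_natDegree_le (hM i j) ?_).symm
  by_cases h0 : v j = 0
  · simp [h0]
  · have := (Polynomial.natDegree_lt_iff_degree_lt h0).mpr (hv j)
    omega

theorem exists_right_inverse_of_sylv_rank {p q e k : ℕ} (hk : 1 ≤ k)
    (M : Matrix (Fin p) (Fin q) F[X])
    (hM : ∀ i j, (M i j).natDegree ≤ e) (h : (sylv e k M).rank = (k + e) * p) :
    ∃ R : Matrix (Fin q) (Fin p) F[X], M * R = 1 := by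
  rw [sylv_rank_iff M hM] at h
  have hcol : ∀ l : Fin p, ∃ v : Fin q → F[X], M *ᵥ v = fun i => (1 : Matrix (Fin p) (Fin p) F[X]) i l := by
    intro l
    obtain ⟨v, -, hv⟩ := h (fun i => (1 : Matrix (Fin p) (Fin p) F[X]) i l) fun i => by
      have h1 : ((1 : Matrix (Fin p) (Fin p) F[X]) i l).degree ≤ 0 := by
        rw [Matrix.one_apply]
        split_ifs <;> simp
      exact h1.trans_lt (by exact_mod_cast (by omega : 0 < k + e))
    exact ⟨v, hv⟩
  choose v hv using hcol
  exact ⟨fun j l => v l j, Matrix.ext fun i l => congrFun (hv l) i⟩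

end FullRowRank

section Minimality

theorem leading_rank_le_rowDeg {p q e : ℕ} (M : Matrix (Fin p) (Fin q) F[X])
    (hM : ∀ i j, (M i j).natDegree ≤ e) (hlead : (coeffMat e M).rank = p)
    (Q : Fin p → F[X]) (hQ : Q ≠ 0) :
    e ≤ Finset.univ.sup fun j => (Matrix.vecMul Q M j).natDegree := by
  classical
  by_contra! hlt
  rw [Finset.sup_lt_iff ((Nat.zero_le _).trans_lt hlt)] at hlt
  obtain ⟨i₁, hi₁⟩ := Function.ne_iff.mp hQ
  obtain ⟨i₀, h₀, hmax⟩ := Finset.exists_max_image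
    (Finset.univ.filter fun i => Q i ≠ 0) (fun i => (Q i).natDegree) ⟨i₁, by simpa using hi₁⟩
  have hle : ∀ i, (Q i).natDegree ≤ (Q i₀).natDegree := by
    intro i
    by_cases hi : Q i = 0
    · simp [hi]
    · exact hmax i (by simpa using hi)
  obtain ⟨B, hB⟩ := (rank_eq_iff_exists_right_inverse _).mp hlead
  set y : Fin p → F := fun i => (Q i).coeff (Q i₀).natDegree with hy
  have hy0 : Matrix.vecMul y (coeffMat e M) = 0 := by
    funext j
    have h1 : (Matrix.vecMul Q M j).coeff ((Q i₀).natDegree + e) = 0 :=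
      Polynomial.coeff_eq_zero_of_natDegree_lt
        ((hlt j (Finset.mem_univ j)).trans_le (Nat.le_add_left _ _))
    rw [Pi.zero_apply, ← h1]
    simp only [Matrix.vecMul, dotProduct, Polynomial.finsetSum_coeff, coeffMat, hy]
    exact Finset.sum_congr rfl fun i _ =>
      (Polynomial.coeff_mul_add_eq_of_natDegree_le (hle i) (hM i j)).symm
  have hy1 : y = 0 := by
    rw [← Matrix.vecMul_one y, ← hB, ← Matrix.vecMul_vecMul, hy0, Matrix.zero_vecMul]
  have h2 : (Q i₀).leadingCoeff = 0 := congrFun hy1 i₀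
  simp only [Finset.mem_filter, Finset.mem_univ, true_and] at h₀
  exact h₀ (Polynomial.leadingCoeff_eq_zero.mp h2)

theorem isMinimalBasis_of_right_inverse {p q e : ℕ} (M : Matrix (Fin p) (Fin q) F[X])
    (hM : ∀ i j, (M i j).natDegree ≤ e) (hlead : (coeffMat e M).rank = p)
    (R : Matrix (Fin q) (Fin p) F[X]) (hR : M * R = 1) : IsMinimalBasis M := by
  have key : ∀ c : Fin p → RatFunc F, ∀ l, c l =
      ∑ j, (∑ i, c i • ratRow M i) j * algebraMap F[X] (RatFunc F) (R j l) := by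
    intro c l
    have h1 : ∀ i, ∑ j, ratRow M i j * algebraMap F[X] (RatFunc F) (R j l)
        = if i = l then 1 else 0 := by
      intro i
      have := congrArg (algebraMap F[X] (RatFunc F)) (congrFun (congrFun hR i) l)
      rw [Matrix.mul_apply, map_sum, Matrix.one_apply] at this
      simp only [map_mul] at this
      refine this.trans ?_
      split_ifs <;> simp
    simp only [Finset.sum_apply, Pi.smul_apply, smul_eq_mul, Finset.sum_mul]
    rw [Finset.sum_comm]
    simp only [mul_assoc, ← Finset.mul_sum, h1]
    simp
  refine ⟨?_, rfl, fun N hN hspan => ?_⟩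
  · rw [Fintype.linearIndependent_iff]
    intro c hc l
    rw [key c l, hc]
    simp
  refine Finset.sum_le_sum fun i _ => ?_
  refine (Finset.sup_le fun j _ => hM i j : rowDeg M i ≤ e).trans ?_
  have hi : ratRow N i ∈ rowSpan M := hspan ▸ Submodule.subset_span ⟨i, rfl⟩
  obtain ⟨c, hc⟩ := (Submodule.mem_span_range_iff_exists_fun _).mp hi
  have hcQ : ∀ l, c l = algebraMap F[X] (RatFunc F) (∑ j, N i j * R j l) := by
    intro l
    rw [key c l, hc, map_sum]
    simp only [map_mul, ratRow]
  have hNQ : N i = Matrix.vecMul (fun l => ∑ j, N i j * R j l) M := by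
    funext j
    apply RatFunc.algebraMap_injective F
    have := congrFun hc j
    simp only [Finset.sum_apply, Pi.smul_apply, smul_eq_mul, ratRow, hcQ] at this
    rw [← this, Matrix.vecMul, dotProduct, map_sum]
    simp only [map_mul]
  have hQ0 : (fun l => ∑ j, N i j * R j l) ≠ 0 := by
    intro h0
    apply hN.ne_zero i
    funext j
    rw [h0, Matrix.zero_vecMul] at hNQ
    simp [ratRow, hNQ]
  have := leading_rank_le_rowDeg M hM hlead _ hQ0
  rw [← hNQ] at this
  exact this

theorem exists_annihilator_mod {p q : ℕ} (M : Matrix (Fin p) (Fin q) F[X])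
    (hR : ¬ ∃ R : Matrix (Fin q) (Fin p) F[X], M * R = 1) :
    ∃ (P : F[X]) (u : Fin p → F[X]) (w : Fin q → F[X]), P ≠ 0 ∧ u ≠ 0 ∧
      (∀ i, (u i).degree < P.degree) ∧ Matrix.vecMul u M = P • w := by
  classical
  rw [← Matrix.mulVec_surjective_iff_exists_right_inverse] at hR
  have hne : LinearMap.range M.mulVecLin ≠ ⊤ := fun h => hR (LinearMap.range_eq_top.mp h)
  obtain ⟨K, hK, hle⟩ := (eq_top_or_exists_le_coatom (LinearMap.range M.mulVecLin)).resolve_left hne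
  obtain ⟨I, hI, ⟨φ⟩⟩ := isSimpleModule_iff_quot_maximal.mp (isSimpleModule_iff_isCoatom.mpr hK)
  set P := Submodule.IsPrincipal.generator I with hP
  have hIP : ∀ f, f ∈ I ↔ P ∣ f := fun f => Submodule.IsPrincipal.mem_iff_generator_dvd I
  have hP0 : P ≠ 0 := by
    intro h
    exact Ring.ne_bot_of_isMaximal_of_not_isField hI (Polynomial.not_isField F)
      ((Submodule.IsPrincipal.eq_bot_iff_generator_eq_zero I).mpr h)
  let ψ : (Fin p → F[X]) →ₗ[F[X]] F[X] ⧸ I := φ.toLinearMap ∘ₗ K.mkQ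
  choose a ha using fun i => Ideal.Quotient.mk_surjective (ψ (Pi.single i 1))
  have hu : ∀ i, Ideal.Quotient.mk I (a i % P) = ψ (Pi.single i 1) := by
    intro i
    rw [← ha i, Ideal.Quotient.eq, hIP]
    exact ⟨-(a i / P), by linear_combination EuclideanDomain.mod_add_div (a i) P⟩
  have hψ : ∀ g : Fin p → F[X], ψ g = Ideal.Quotient.mk I (∑ i, (a i % P) * g i) := by
    intro g
    rw [LinearMap.pi_apply_eq_sum_univ ψ g, map_sum]
    refine Finset.sum_congr rfl fun i _ => ?_
    have : (fun j => if i = j then (1 : F[X]) else 0) = Pi.single i 1 := by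
      funext j
      simp [Pi.single_apply, eq_comm]
    rw [this, ← hu, mul_comm]
    rfl
  have hw : ∀ j, P ∣ Matrix.vecMul (fun i => a i % P) M j := by
    intro j
    rw [← hIP, ← Ideal.Quotient.eq_zero_iff_mem]
    have h0 : ψ (M *ᵥ Pi.single j 1) = 0 := by
      have hm : M *ᵥ Pi.single j 1 ∈ K := hle ⟨_, rfl⟩
      change φ (K.mkQ _) = 0
      rw [Submodule.mkQ_apply, (Submodule.Quotient.mk_eq_zero K).mpr hm, map_zero]
    rw [hψ] at h0
    simpa [Matrix.vecMul, dotProduct] using h0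
  choose w hw using hw
  refine ⟨P, fun i => a i % P, w, hP0, ?_, fun i => Polynomial.degree_mod_lt _ hP0, ?_⟩
  · intro h0
    obtain ⟨g, hg⟩ := (φ.surjective.comp K.mkQ_surjective) (Ideal.Quotient.mk I 1)
    have hg' : ψ g = Ideal.Quotient.mk I 1 := hg
    rw [hψ] at hg'
    have h0' : ∀ i, a i % P = 0 := fun i => congrFun h0 i
    simp only [h0', zero_mul, Finset.sum_const_zero] at hg'
    rw [eq_comm, Ideal.Quotient.eq, sub_zero] at hg'
    exact hI.ne_top ((Ideal.eq_top_iff_one I).mpr hg')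
  · funext j
    exact hw j

theorem span_range_update_eq {ι K V : Type*} [DecidableEq ι] [Fintype ι] [Field K] [AddCommGroup V]
    [Module K V] (b : ι → V) (c : ι → K) (i₀ : ι) (hc : c i₀ ≠ 0) :
    Submodule.span K (Set.range (Function.update b i₀ (∑ i, c i • b i)))
      = Submodule.span K (Set.range b) := by
  set x := ∑ i, c i • b i with hx
  have hmem : ∀ i ≠ i₀, b i ∈ Submodule.span K (Set.range (Function.update b i₀ x)) :=
    fun i hi => Submodule.subset_span ⟨i, Function.update_of_ne hi _ _⟩
  apply le_antisymm
  · rw [Submodule.span_le]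
    rintro _ ⟨i, rfl⟩
    by_cases hi : i = i₀
    · subst hi
      rw [Function.update_self]
      exact Submodule.sum_mem _ fun i _ =>
        Submodule.smul_mem _ _ (Submodule.subset_span ⟨i, rfl⟩)
    · rw [Function.update_of_ne hi]
      exact Submodule.subset_span ⟨i, rfl⟩
  · rw [Submodule.span_le]
    rintro _ ⟨i, rfl⟩
    by_cases hi : i = i₀
    · subst hi
      have h1 : c i • b i = x - ∑ l ∈ Finset.univ.erase i, c l • b l := by
        rw [hx, ← Finset.add_sum_erase _ _ (Finset.mem_univ i), add_sub_cancel_right]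
      have h2 : c i • b i ∈ Submodule.span K (Set.range (Function.update b i x)) := by
        rw [h1]
        refine Submodule.sub_mem _ (Submodule.subset_span ⟨i, Function.update_self _ _ _⟩) ?_
        exact Submodule.sum_mem _ fun l hl =>
          Submodule.smul_mem _ _ (hmem l (Finset.ne_of_mem_erase hl))
      exact (Submodule.smul_mem_iff _ hc).mp h2
    · exact hmem i hi

theorem IsMinimalBasis.exists_right_inverse {p q e : ℕ} (he : 0 < e)
    (M : Matrix (Fin p) (Fin q) F[X]) (hM : ∀ i j, (M i j).natDegree ≤ e)
    (hlead : (coeffMat e M).rank = p) (hmb : IsMinimalBasis M) :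
    ∃ R : Matrix (Fin q) (Fin p) F[X], M * R = 1 := by
  by_contra hR
  obtain ⟨P, u, w, hP, hu, hdeg, huw⟩ := exists_annihilator_mod M hR
  obtain ⟨i₀, hi₀⟩ := Function.ne_iff.mp hu
  have hPr : algebraMap F[X] (RatFunc F) P ≠ 0 := by
    rwa [Ne, FaithfulSMul.algebraMap_eq_zero_iff]
  have hur : algebraMap F[X] (RatFunc F) (u i₀) ≠ 0 := by
    rwa [Ne, FaithfulSMul.algebraMap_eq_zero_iff]
  have hwdeg : ∀ j, (w j).natDegree < e := by
    intro j
    by_cases hw0 : w j = 0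
    · simpa [hw0] using he
    have h1 : (P * w j).degree < ((P.natDegree + e : ℕ) : WithBot ℕ) := by
      have : P * w j = Matrix.vecMul u M j := by rw [huw]; rfl
      rw [this, Matrix.vecMul, dotProduct]
      exact degree_finsetSum_lt fun i _ =>
        degree_mul_lt ((hdeg i).trans_le Polynomial.degree_le_natDegree) (hM i j)
    rw [← Polynomial.natDegree_lt_iff_degree_lt (mul_ne_zero hP hw0),
      Polynomial.natDegree_mul hP hw0] at h1
    omega
  set N := M.updateRow i₀ w with hN
  have hrat : ratRow N = Function.update (ratRow M) i₀
      (∑ i, (algebraMap F[X] (RatFunc F) (u i) / algebraMap F[X] (RatFunc F) P) • ratRow M i) := by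
    funext i j
    by_cases hi : i = i₀
    · subst hi
      have h1 := congrArg (algebraMap F[X] (RatFunc F)) (congrFun huw j)
      simp only [Matrix.vecMul, dotProduct, map_sum, map_mul, Pi.smul_apply, smul_eq_mul] at h1
      rw [Function.update_self]
      simp only [ratRow, hN, Matrix.updateRow_self, Finset.sum_apply, Pi.smul_apply, smul_eq_mul]
      simp only [div_mul_eq_mul_div]
      rw [← Finset.sum_div, h1]
      field_simp
    · rw [Function.update_of_ne hi]
      simp only [ratRow, hN, Matrix.updateRow_ne hi]
  have hspan : rowSpan N = rowSpan M := by
    rw [rowSpan, hrat]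
    exact span_range_update_eq (ratRow M) _ i₀ (div_ne_zero hur hPr)
  have hind : LinearIndependent (RatFunc F) (ratRow N) := by
    rw [linearIndependent_iff_card_eq_finrank_span]
    exact (linearIndependent_iff_card_eq_finrank_span.mp hmb.1).trans
      (congrArg (fun V : Submodule _ _ => Module.finrank (RatFunc F) V) hspan).symm
  have hle := hmb.2.2 N hind hspan
  have hlt : rowDeg N i₀ < rowDeg M i₀ := by
    have h1 := leading_rank_le_rowDeg M hM hlead (Pi.single i₀ 1) (by simp)
    rw [Matrix.single_one_vecMul] at h1
    refine lt_of_lt_of_le ((Finset.sup_lt_iff he).mpr fun j _ => ?_) h1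
    simpa [hN] using hwdeg j
  refine absurd hle (not_le.mpr (Finset.sum_lt_sum (fun i _ => ?_) ⟨i₀, Finset.mem_univ _, hlt⟩))
  by_cases hi : i = i₀
  · exact hi ▸ hlt.le
  · simp only [rowDeg, hN, Matrix.updateRow_ne hi, le_refl]

end Minimality

section Perturbation

variable {a b : Type*} [Fintype a] [Fintype b] [DecidableEq b]

theorem norm_toEuclideanLin_le (A : Matrix a b 𝕜) (x : EuclideanSpace 𝕜 b) :
    ‖Matrix.toEuclideanLin A x‖ ≤ sNorm A * ‖x‖ :=
  (LinearMap.toContinuousLinearMap (Matrix.toEuclideanLin A)).le_opNorm x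

/-- A perturbation whose spectral norm is below the `j`-th singular value preserves
`rank ≥ j`. -/
theorem le_rank_of_norm_sub_lt_singVal (A B : Matrix a b 𝕜) (j : ℕ) (s : ℝ) (hs0 : 0 ≤ s)
    (hs : ∀ x, ‖Matrix.toEuclideanLin (A - B) x‖ ≤ s * ‖x‖) (h : s < singVal A j) :
    j ≤ B.rank := by
  have hne : {r : ℝ | ∃ V : Submodule 𝕜 (EuclideanSpace 𝕜 b),
      Module.finrank 𝕜 V = j ∧ ∀ x ∈ V, r * ‖x‖ ≤ ‖Matrix.toEuclideanLin A x‖}.Nonempty := by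
    by_contra hemp
    rw [Set.not_nonempty_iff_eq_empty] at hemp
    rw [singVal, hemp, Real.sSup_empty] at h
    linarith
  obtain ⟨r, ⟨V, hV, hr⟩, hsr⟩ := exists_lt_of_lt_csSup hne h
  have hinj : Function.Injective ((Matrix.toEuclideanLin B).domRestrict V) := by
    rw [← LinearMap.ker_eq_bot, LinearMap.ker_eq_bot']
    rintro ⟨x, hx⟩ hBx
    have hBx' : Matrix.toEuclideanLin B x = 0 := hBx
    have h1 := hr x hx
    have h2 := hs x
    rw [map_sub, LinearMap.sub_apply, hBx', sub_zero] at h2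
    have : ‖x‖ = 0 := by
      by_contra h0
      have : 0 < ‖x‖ := lt_of_le_of_ne (norm_nonneg x) (Ne.symm h0)
      nlinarith
    exact Subtype.ext (norm_eq_zero.mp this)
  have h3 := LinearMap.finrank_range_of_inj hinj
  rw [hV] at h3
  rw [← h3, Matrix.rank_eq_finrank_range_toLin B (PiLp.basisFun 2 𝕜 a) (PiLp.basisFun 2 𝕜 b)]
  apply Submodule.finrank_mono
  rintro _ ⟨x, rfl⟩
  exact ⟨x, rfl⟩

theorem sylv_sub {p q e k : ℕ} (M N : Matrix (Fin p) (Fin q) F[X]) :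
    sylv e k (M - N) = sylv e k M - sylv e k N := by
  ext r c
  simp only [sylv, Matrix.sub_apply]
  split_ifs <;> simp

theorem norm_sylv_blockCol {p q e k : ℕ} (M : Matrix (Fin p) (Fin q) 𝕜[X]) (c : Fin k)
    (y : Fin q → 𝕜) :
    ‖(WithLp.toLp 2 fun r => ∑ j, sylv e k M r (c, j) * y j :
        EuclideanSpace 𝕜 (Fin (k + e) × Fin p))‖
      = ‖Matrix.toEuclideanLin (sylv e 1 M) (WithLp.toLp 2 fun s : Fin 1 × Fin q => y s.2)‖ := by
  rw [EuclideanSpace.norm_eq, EuclideanSpace.norm_eq]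
  congr 1
  symm
  refine Fintype.sum_of_injective
    (fun t : Fin (1 + e) × Fin p => ((⟨c + t.1, by omega⟩ : Fin (k + e)), t.2)) ?_ _ _ ?_ ?_
  · rintro ⟨t, i⟩ ⟨t', i'⟩ h
    simp only [Prod.mk.injEq, Fin.mk.injEq] at h
    ext <;> simp <;> omega
  · rintro ⟨r, i⟩ hr
    have : ¬((c : ℕ) ≤ r ∧ (r : ℕ) ≤ c + e) := by
      rintro ⟨h1, h2⟩
      exact hr ⟨(⟨r - c, by omega⟩, i), by ext <;> simp; omega⟩
    simp [sylv, this]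
  · rintro ⟨t, i⟩
    have h1 : (t : ℕ) ≤ e := by omega
    simp [Matrix.mulVec, dotProduct, Fintype.sum_prod_type, sylv, h1]

theorem norm_sylv_le {p q e k : ℕ} (M : Matrix (Fin p) (Fin q) 𝕜[X])
    (x : EuclideanSpace 𝕜 (Fin k × Fin q)) :
    ‖Matrix.toEuclideanLin (sylv e k M) x‖ ≤ Real.sqrt k * sNorm (sylv e 1 M) * ‖x‖ := by
  let X : Fin k → EuclideanSpace 𝕜 (Fin 1 × Fin q) := fun c =>
    WithLp.toLp 2 fun s => x (c, s.2)
  have hdecomp : Matrix.toEuclideanLin (sylv e k M) x = ∑ c : Fin k,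
      (WithLp.toLp 2 fun r => ∑ j, sylv e k M r (c, j) * x (c, j) :
        EuclideanSpace 𝕜 (Fin (k + e) × Fin p)) := by
    ext r
    simp [Matrix.mulVec, dotProduct, Fintype.sum_prod_type]
  have hX : ∑ c, ‖X c‖ ^ 2 = ‖x‖ ^ 2 := by
    simp [EuclideanSpace.norm_sq_eq, X, Fintype.sum_prod_type]
  have hCS : ∑ c, ‖X c‖ ≤ Real.sqrt k * ‖x‖ := by
    have h1 := sq_sum_le_card_mul_sum_sq (s := Finset.univ) (f := fun c => ‖X c‖)
    rw [hX, Finset.card_univ, Fintype.card_fin] at h1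
    refine (pow_le_pow_iff_left₀ (by positivity) (by positivity) two_ne_zero).mp ?_
    rwa [mul_pow, Real.sq_sqrt (Nat.cast_nonneg k)]
  rw [hdecomp]
  calc _ ≤ ∑ c : Fin k, ‖Matrix.toEuclideanLin (sylv e 1 M) (X c)‖ :=
        (norm_sum_le _ _).trans_eq
          (Finset.sum_congr rfl fun c _ => norm_sylv_blockCol M c fun j => x (c, j))
    _ ≤ ∑ c : Fin k, sNorm (sylv e 1 M) * ‖X c‖ :=
        Finset.sum_le_sum fun c _ => norm_toEuclideanLin_le _ _
    _ = sNorm (sylv e 1 M) * ∑ c, ‖X c‖ := by rw [Finset.mul_sum]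
    _ ≤ sNorm (sylv e 1 M) * (Real.sqrt k * ‖x‖) :=
        mul_le_mul_of_nonneg_left hCS (norm_nonneg _)
    _ = _ := by ring

end Perturbation

/-- Robustness of minimal bases with full rank leading coefficient: some Sylvester
matrix `S_k(M)` has full row rank, and for any such `k` every polynomial matrix
`M̃` of degree at most `d` with `‖S_1(M) - S_1(M̃)‖_2 < σ_{(k+d)m}(S_k(M))/√k` is a
minimal basis with full rank leading coefficient. -/
theorem robust_of_rank_leading_eq {𝕜 : Type*} [RCLike 𝕜] {m n d : ℕ}
    (hm : 0 < m) (hn : 0 < n) (hd : 0 < d)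
    (M : Matrix (Fin m) (Fin (m + n)) 𝕜[X]) (hdeg : ∀ i j, (M i j).natDegree ≤ d)
    (hmb : IsMinimalBasis M) (hMd : (coeffMat d M).rank = m) :
    (∃ k : ℕ, 1 ≤ k ∧ (sylv d k M).rank = (k + d) * m) ∧
    ∀ k : ℕ, 1 ≤ k → (sylv d k M).rank = (k + d) * m →
      ∀ M' : Matrix (Fin m) (Fin (m + n)) 𝕜[X], (∀ i j, (M' i j).natDegree ≤ d) →
        sNorm (sylv d 1 M - sylv d 1 M')
            < singVal (sylv d k M) ((k + d) * m) / Real.sqrt k →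
        IsMinimalBasis M' ∧ (coeffMat d M').rank = m := by
  obtain ⟨R, hR⟩ := hmb.exists_right_inverse hd M hdeg hMd
  refine ⟨exists_sylv_rank_eq hd M hdeg hMd R hR, fun k hk _ M' hdeg' hlt => ?_⟩
  have hk0 : 0 < Real.sqrt k := Real.sqrt_pos.mpr (by exact_mod_cast hk)
  rw [lt_div_iff₀ hk0, mul_comm, ← sylv_sub] at hlt
  have hle := le_rank_of_norm_sub_lt_singVal (sylv d k M) (sylv d k M') _ _
    (mul_nonneg hk0.le (norm_nonneg _))
    (fun x => by rw [← sylv_sub]; exact norm_sylv_le (M - M') x) hlt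
  have hrank : (sylv d k M').rank = (k + d) * m :=
    le_antisymm ((Matrix.rank_le_card_height _).trans (by simp)) hle
  have hlead := rank_leading_of_sylv_rank hk M' hdeg' hrank
  obtain ⟨R', hR'⟩ := exists_right_inverse_of_sylv_rank hk M' hdeg' hrank
  exact ⟨isMinimalBasis_of_right_inverse M' hdeg' hlead R' hR', hlead⟩

end
end
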